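/- There exist constants C > 0 and N such that for all n ≥ m ≥ N, the minimum number of walls in a solution of the wall-stop sliding game on the rectangular grid satisfies |opt^S_W(G_{n,m}) − nm/2| ≤ C·(m+n); that is, opt^S_W(G_{n,m}) = nm/2 + O(m+n). -/

import Mathlib

/-- Squares, given as (row, column) pairs of integers. -/
abbrev Sq : Type := ℤ × ℤ

/-- `p` is a square of the grid `G_{n,m}` (rows `1..n`, columns `1..m`). -/
def inGrid (n m : ℕ) (p : Sq) : Prop :=
  1 ≤ p.1 ∧ p.1 ≤ (n : ℤ) ∧ 1 ≤ p.2 ∧ p.2 ≤ (m : ℤ)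

/-- A wall, recorded as the ordered pair of the two adjacent grid squares it
separates (right neighbour for a vertical wall, lower neighbour for a horizontal
wall).  A vertical wall `(p, p + (0,1))` separates two horizontally adjacent squares;
a horizontal wall `(p, p + (1,0))` separates two vertically adjacent squares. -/
def IsWall (n m : ℕ) (w : Sq × Sq) : Prop :=
  inGrid n m w.1 ∧ inGrid n m w.2 ∧
    (w.2 = w.1 + ((0 : ℤ), (1 : ℤ)) ∨ w.2 = w.1 + ((1 : ℤ), (0 : ℤ)))

/-- All members of `W` are genuine walls of the grid `G_{n,m}`. -/
def WallsOK (n m : ℕ) (W : Finset (Sq × Sq)) : Prop := ∀ w ∈ W, IsWall n m w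

/-- There is a wall of `W` on the common (by omega) of the squares `p` and `q`. -/
def WallBetween (W : Finset (Sq × Sq)) (p q : Sq) : Prop :=
  (p, q) ∈ W ∨ (q, p) ∈ W

/-- The four axis directions. -/
def dirs4 : Set Sq := {(1, 0), (-1, 0), (0, 1), (0, -1)}

/-- Sliding from `p` in direction `d`, with walls `W`, travels exactly `k` steps:
all squares along the way are on the grid, no crossed (by omega) carries a wall, and the
next (by omega) is a wall of `W` or lies on the grid boundary. -/
def IsSlideW (n m : ℕ) (W : Finset (Sq × Sq)) (p d : Sq) (k : ℕ) : Prop :=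
  (∀ t : ℕ, t ≤ k → inGrid n m (p + (t : ℤ) • d)) ∧
  (∀ t : ℕ, t < k → ¬ WallBetween W (p + (t : ℤ) • d) (p + ((t : ℤ) + 1) • d)) ∧
  (¬ inGrid n m (p + ((k : ℤ) + 1) • d) ∨
    WallBetween W (p + (k : ℤ) • d) (p + ((k : ℤ) + 1) • d))

/-- One move of the robot: slide from `p` in some axis direction, stopping at `q`. -/
def MoveW (n m : ℕ) (W : Finset (Sq × Sq)) (p q : Sq) : Prop :=
  ∃ d ∈ dirs4, ∃ k : ℕ, IsSlideW n m W p d k ∧ q = p + (k : ℤ) • d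

/-- The robot, starting on `p`, can stop on `q` after a finite sequence of moves. -/
def ReachesW (n m : ℕ) (W : Finset (Sq × Sq)) : Sq → Sq → Prop :=
  Relation.ReflTransGen (MoveW n m W)

/-- The robot, starting on `p₀`, passes over the square `s`: during some move of a
finite sequence of moves it occupies or slides through `s`. -/
def PassesW (n m : ℕ) (W : Finset (Sq × Sq)) (p₀ s : Sq) : Prop :=
  ∃ p, ReachesW n m W p₀ p ∧ ∃ d ∈ dirs4, ∃ k t : ℕ,
    IsSlideW n m W p d k ∧ t ≤ k ∧ s = p + (t : ℤ) • d

/-- `W` solves the wall-stop game on `G_{n,m}`: starting from `(1,1)`, the robot can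
stop on every square of the grid (the starting square counts as reachable). -/
def SolvesStopW (n m : ℕ) (W : Finset (Sq × Sq)) : Prop :=
  WallsOK n m W ∧ ∀ s : Sq, inGrid n m s → ReachesW n m W (1, 1) s

/-- `opt^S_W(G_{n,m})`: the minimum number of walls solving the wall-stop game. -/
noncomputable def optSW (n m : ℕ) : ℕ :=
  sInf {k | ∃ W : Finset (Sq × Sq), SolvesStopW n m W ∧ W.card = k}


/-- wall on the right (by omega) of `(i,j)` -/
def vw (n m i j : ℤ) : Prop :=
  1 ≤ i ∧ i ≤ n ∧ 1 ≤ j ∧ j < m ∧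
    ((2 ≤ i ∧ i ≤ n - 1 ∧ (i + j) % 4 = 0) ∨ (i = 1 ∧ j % 4 = 0) ∨ (i = n ∧ (i + j) % 4 = 3))

/-- wall below `(i,j)` -/
def hw (n m i j : ℤ) : Prop :=
  1 ≤ i ∧ i < n ∧ 1 ≤ j ∧ j ≤ m ∧
    ((2 ≤ j ∧ j ≤ m - 1 ∧ (i + j) % 4 = 2) ∨ (j = 1 ∧ i % 4 = 2) ∨ (j = m ∧ (i + j) % 4 = 1))

/-- A reachability predicate closed under the four kinds of slides. -/
structure Closed (n m : ℤ) (R : ℤ → ℤ → Prop) : Prop where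
  start : R 1 1
  right : ∀ i j j', R i j → 1 ≤ i → i ≤ n → 1 ≤ j → j ≤ j' → j' ≤ m →
    (∀ t, j ≤ t → t < j' → ¬ vw n m i t) → (j' = m ∨ vw n m i j') → R i j'
  left : ∀ i j j', R i j → 1 ≤ i → i ≤ n → 1 ≤ j' → j' ≤ j → j ≤ m →
    (∀ t, j' ≤ t → t < j → ¬ vw n m i t) → (j' = 1 ∨ vw n m i (j' - 1)) → R i j'
  down : ∀ i i' j, R i j → 1 ≤ j → j ≤ m → 1 ≤ i → i ≤ i' → i' ≤ n →
    (∀ t, i ≤ t → t < i' → ¬ hw n m t j) → (i' = n ∨ hw n m i' j) → R i' j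
  up : ∀ i i' j, R i j → 1 ≤ j → j ≤ m → 1 ≤ i' → i' ≤ i → i ≤ n →
    (∀ t, i' ≤ t → t < i → ¬ hw n m t j) → (i' = 1 ∨ hw n m (i' - 1) j) → R i' j

section
variable {n m : ℤ} {R : ℤ → ℤ → Prop}

theorem mvR (h : Closed n m R) (i j j' : ℤ) (hr : R i j) (h1 : 1 ≤ i ∧ i ≤ n ∧ 1 ≤ j ∧ j ≤ j' ∧ j' ≤ m := by omega)
    (h6 : ∀ t, j ≤ t → t < j' → ¬ vw n m i t := by intro t _ _; unfold vw; omega)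
    (h7 : j' = m ∨ vw n m i j' := by unfold vw; omega) : R i j' :=
  h.right i j j' hr h1.1 h1.2.1 h1.2.2.1 h1.2.2.2.1 h1.2.2.2.2 h6 h7

theorem mvL (h : Closed n m R) (i j j' : ℤ) (hr : R i j) (h1 : 1 ≤ i ∧ i ≤ n ∧ 1 ≤ j' ∧ j' ≤ j ∧ j ≤ m := by omega)
    (h6 : ∀ t, j' ≤ t → t < j → ¬ vw n m i t := by intro t _ _; unfold vw; omega)
    (h7 : j' = 1 ∨ vw n m i (j' - 1) := by unfold vw; omega) : R i j' :=
  h.left i j j' hr h1.1 h1.2.1 h1.2.2.1 h1.2.2.2.1 h1.2.2.2.2 h6 h7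

theorem mvD (h : Closed n m R) (i i' j : ℤ) (hr : R i j) (h1 : 1 ≤ j ∧ j ≤ m ∧ 1 ≤ i ∧ i ≤ i' ∧ i' ≤ n := by omega)
    (h6 : ∀ t, i ≤ t → t < i' → ¬ hw n m t j := by intro t _ _; unfold hw; omega)
    (h7 : i' = n ∨ hw n m i' j := by unfold hw; omega) : R i' j :=
  h.down i i' j hr h1.1 h1.2.1 h1.2.2.1 h1.2.2.2.1 h1.2.2.2.2 h6 h7

theorem mvU (h : Closed n m R) (i i' j : ℤ) (hr : R i j) (h1 : 1 ≤ j ∧ j ≤ m ∧ 1 ≤ i' ∧ i' ≤ i ∧ i ≤ n := by omega)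
    (h6 : ∀ t, i' ≤ t → t < i → ¬ hw n m t j := by intro t _ _; unfold hw; omega)
    (h7 : i' = 1 ∨ hw n m (i' - 1) j := by unfold hw; omega) : R i' j :=
  h.up i i' j hr h1.1 h1.2.1 h1.2.2.1 h1.2.2.2.1 h1.2.2.2.2 h6 h7


/-- the H-segment `[a, a+3]` in row `i` is fully reached -/
def Core (n m : ℤ) (R : ℤ → ℤ → Prop) (i a : ℤ) : Prop :=
  2 ≤ i → i ≤ n - 1 → 1 ≤ a → a ≤ m - 3 → (i + a) % 4 = 1 → R i a ∧ R i (a + 3)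

theorem seg (h : Closed n m R) (i a x : ℤ) (h1 : 2 ≤ i) (h2 : i ≤ n - 1) (h3 : 1 ≤ a)
    (h4 : a ≤ m - 3) (h5 : (i + a) % 4 = 1) (hx : R i x) (h6 : a ≤ x) (h7 : x ≤ a + 3) :
    R i a ∧ R i (a + 3) :=
  ⟨mvL h i x a hx,
   mvR h i x (a+3) hx⟩

theorem core_dl (h : Closed n m R) (i a : ℤ) (h1 : 2 ≤ i) (h2 : i + 1 ≤ n - 1) (h3 : 2 ≤ a)
    (h4 : a ≤ m - 3) (h5 : (i + a) % 4 = 1) (hc : R i a) :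
    R (i+1) (a-1) ∧ R (i+1) (a-1+3) := by
  have := mvD h i (i+1) a hc
  exact seg h (i+1) (a-1) a (by omega) (by omega) (by omega) (by omega) (by omega) this (by omega) (by omega)

theorem core_ur (h : Closed n m R) (i a : ℤ) (h1 : 3 ≤ i) (h2 : i ≤ n - 1) (h3 : 1 ≤ a)
    (h4 : a + 1 ≤ m - 3) (h5 : (i + a) % 4 = 1) (hc : R i (a+3)) :
    R (i-1) (a+1) ∧ R (i-1) (a+1+3) := by
  have := mvU h i (i-1) (a+3) hc
  exact seg h (i-1) (a+1) (a+3) (by omega) (by omega) (by omega) (by omega) (by omega) this (by omega) (by omega)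

theorem core_dr (h : Closed n m R) (i a : ℤ) (h1 : 2 ≤ i) (h2 : i + 2 ≤ n - 1) (h3 : 1 ≤ a)
    (h4 : a + 2 ≤ m - 3) (h5 : (i + a) % 4 = 1) (hc : R i (a+3)) :
    R (i+2) (a+2) ∧ R (i+2) (a+2+3) := by
  have := mvD h i (i+2) (a+3) hc
  exact seg h (i+2) (a+2) (a+3) (by omega) (by omega) (by omega) (by omega) (by omega) this (by omega) (by omega)

theorem anti_down (h : Closed n m R) (i a : ℤ) (h1 : 2 ≤ i) (h4 : a ≤ m - 3)
    (h5 : (i + a) % 4 = 1) (hc : R i a ∧ R i (a+3)) (k : ℕ) :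
    i + k ≤ n - 1 → 1 ≤ a - k → R (i+k) (a-k) ∧ R (i+k) (a-k+3) := by
  induction k with
  | zero => intro _ _; simpa using hc
  | succ k ih =>
    intro e1 e2
    push_cast at e1 e2 ⊢
    have := core_dl h (i+k) (a-k) (by omega) (by omega) (by omega) (by omega) (by omega) (ih (by omega) (by omega)).1
    rw [show i + ((k:ℤ)+1) = i + k + 1 by ring, show a - ((k:ℤ)+1) = a - k - 1 by ring]
    exact this

theorem anti_up (h : Closed n m R) (i a : ℤ) (h1 : i ≤ n - 1) (h4 : 1 ≤ a)
    (h5 : (i + a) % 4 = 1) (hc : R i a ∧ R i (a+3)) (k : ℕ) :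
    2 ≤ i - k → a + k ≤ m - 3 → R (i-k) (a+k) ∧ R (i-k) (a+k+3) := by
  induction k with
  | zero => intro _ _; simpa using hc
  | succ k ih =>
    intro e1 e2
    push_cast at e1 e2 ⊢
    have := core_ur h (i-k) (a+k) (by omega) (by omega) (by omega) (by omega) (by omega) (ih (by omega) (by omega)).2
    rw [show i - ((k:ℤ)+1) = i - k - 1 by ring, show a + ((k:ℤ)+1) = a + k + 1 by ring]
    exact this

theorem anti (h : Closed n m R) (i a i' a' : ℤ) (h1 : 2 ≤ i) (h2 : i ≤ n - 1) (h3 : 1 ≤ a)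
    (h4 : a ≤ m - 3) (h5 : (i + a) % 4 = 1) (hc : R i a ∧ R i (a+3)) (e : i + a = i' + a')
    (h1' : 2 ≤ i') (h2' : i' ≤ n - 1) (h3' : 1 ≤ a') (h4' : a' ≤ m - 3) :
    R i' a' ∧ R i' (a'+3) := by
  rcases le_total i i' with hle | hle
  · obtain ⟨k, hk⟩ := Int.le.dest hle
    have := anti_down h i a h1 h4 h5 hc k (by omega) (by omega)
    rwa [show i + (k:ℤ) = i' by omega, show a - (k:ℤ) = a' by omega] at this
  · obtain ⟨k, hk⟩ := Int.le.dest hle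
    have := anti_up h i a h2 h3 h5 hc k (by omega) (by omega)
    rwa [show i - (k:ℤ) = i' by omega, show a + (k:ℤ) = a' by omega] at this

theorem core_all (h : Closed n m R) (hn : 12 ≤ n) (hm : 12 ≤ m) (k : ℕ) :
    ∀ i a : ℤ, i + a = 5 + 4 * k → Core n m R i a := by
  induction k with
  | zero =>
    intro i a e h1 h2 h3 h4 h5
    have r1 := mvR h 1 1 4 h.start
    have r2 := mvD h 1 2 4 r1
    have r3 := seg h 2 3 4 (by omega) (by omega) (by omega) (by omega) (by omega) r2 (by omega) (by omega)
    exact anti h 2 3 i a (by omega) (by omega) (by omega) (by omega) (by omega) r3 (by omega) (by omega) (by omega) (by omega) (by omega)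
  | succ k ih =>
    intro i a e h1 h2 h3 h4 h5
    push_cast at e
    obtain ⟨i0, a0, q1, q2, q3, q4, q5⟩ : ∃ i0 a0 : ℤ, 4 ≤ i0 ∧ i0 ≤ n - 1 ∧ 3 ≤ a0 ∧ a0 ≤ m - 3 ∧
        i0 + a0 = i + a := by
      by_cases hi : i + a - 3 ≤ n - 1
      · exact ⟨i + a - 3, 3, by omega, by omega, by omega, by omega, by omega⟩
      · exact ⟨n - 1, i + a - (n - 1), by omega, by omega, by omega, by omega, by omega⟩
    have r := ih (i0-2) (a0-2) (by omega) (by omega) (by omega) (by omega) (by omega) (by omega)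
    have r2 := core_dr h (i0-2) (a0-2) (by omega) (by omega) (by omega) (by omega) (by omega) r.2
    rw [show i0 - 2 + 2 = i0 by ring, show a0 - 2 + 2 = a0 by ring] at r2
    exact anti h i0 a0 i a (by omega) (by omega) (by omega) (by omega) (by omega) r2 (by omega) (by omega) (by omega) (by omega) (by omega)

theorem core (h : Closed n m R) (hn : 12 ≤ n) (hm : 12 ≤ m) (i a : ℤ) : Core n m R i a := by
  intro h1 h2 h3 h4 h5
  exact core_all h hn hm ((i + a - 5) / 4).toNat i a (by omega) h1 h2 h3 h4 h5

theorem T1 (h : Closed n m R) (hn : 12 ≤ n) (hm : 12 ≤ m) (i j : ℤ) (h1 : 2 ≤ i) (h2 : i ≤ n - 1)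
    (h3 : 1 ≤ j) (h4 : j ≤ m - 3) (h5 : (i + j) % 4 = 1) : R i j :=
  (core h hn hm i j h1 h2 h3 h4 h5).1

theorem T0 (h : Closed n m R) (hn : 12 ≤ n) (hm : 12 ≤ m) (i j : ℤ) (h1 : 2 ≤ i) (h2 : i ≤ n - 1)
    (h3 : 4 ≤ j) (h4 : j ≤ m) (h5 : (i + j) % 4 = 0) : R i j := by
  have := (core h hn hm i (j-3) (by omega) (by omega) (by omega) (by omega) (by omega)).2
  rwa [show j - 3 + 3 = j by ring] at this

theorem T0_3 (h : Closed n m R) (hn : 12 ≤ n) (hm : 12 ≤ m) (i : ℤ) (h1 : 2 ≤ i) (h2 : i ≤ n - 1)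
    (h5 : (i + 3) % 4 = 0) : R i 3 := by
  have key : R i 2 := by
    by_cases c : i + 2 ≤ n - 1
    · have r := T1 h hn hm (i+2) 2 (by omega) (by omega) (by omega) (by omega) (by omega)
      exact mvU h (i+2) i 2 r
    · by_cases c2 : i = n - 2
      · have r1 := T1 h hn hm (i-1) 1 (by omega) (by omega) (by omega) (by omega) (by omega)
        have r2 := mvD h (i-1) (i+1) 1 r1
        have r3 := mvR h (i+1) 1 2 r2
        exact mvU h (i+1) i 2 r3
      · have r1 := T1 h hn hm i 4 (by omega) (by omega) (by omega) (by omega) (by omega)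
        have r2 := mvD h i n 4 r1
        have r3 := mvL h n 4 2 r2
        exact mvU h n i 2 r3
  exact mvR h i 2 3 key

theorem T0_2 (h : Closed n m R) (hn : 12 ≤ n) (hm : 12 ≤ m) (i : ℤ) (h1 : 2 ≤ i) (h2 : i ≤ n - 1)
    (h5 : (i + 2) % 4 = 0) : R i 2 := by
  have key : R i 1 := by
    by_cases c : i = 2
    · exact mvD h 1 i 1 h.start
    · have r1 := T1 h hn hm (i-2) 1 (by omega) (by omega) (by omega) (by omega) (by omega)
      exact mvD h (i-2) i 1 r1
  exact mvR h i 1 2 key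

theorem T0_1 (h : Closed n m R) (hn : 12 ≤ n) (hm : 12 ≤ m) (i : ℤ) (h1 : 2 ≤ i) (h2 : i ≤ n - 1)
    (h5 : (i + 1) % 4 = 0) : R i 1 := by
  by_cases c : i = n - 1
  · have r1 := T1 h hn hm i 2 (by omega) (by omega) (by omega) (by omega) (by omega)
    have r2 := mvD h i n 2 r1
    have r3 := mvL h n 2 1 r2
    exact mvU h n i 1 r3
  · have r1 := T1 h hn hm (i+1) 1 (by omega) (by omega) (by omega) (by omega) (by omega)
    exact mvU h (i+1) i 1 r1

theorem E0 (h : Closed n m R) (hn : 12 ≤ n) (hm : 12 ≤ m) (i j : ℤ) (h1 : 2 ≤ i) (h2 : i ≤ n - 1)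
    (h3 : 1 ≤ j) (h4 : j ≤ m) (h5 : (i + j) % 4 = 0) : R i j := by
  by_cases c : 4 ≤ j
  · exact T0 h hn hm i j h1 h2 c h4 h5
  · obtain rfl | rfl | rfl : j = 1 ∨ j = 2 ∨ j = 3 := by omega
    · exact T0_1 h hn hm i h1 h2 h5
    · exact T0_2 h hn hm i h1 h2 h5
    · exact T0_3 h hn hm i h1 h2 h5

theorem T1_2 (h : Closed n m R) (hn : 12 ≤ n) (hm : 12 ≤ m) (i : ℤ) (h1 : 2 ≤ i) (h2 : i ≤ n - 1)
    (h5 : (i + m) % 4 = 3) : R i (m-2) := by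
  have key : R i (m-1) := by
    by_cases c : 4 ≤ i
    · have r := T0 h hn hm (i-2) (m-1) (by omega) (by omega) (by omega) (by omega) (by omega)
      exact mvD h (i-2) i (m-1) r
    · by_cases c2 : i = 3
      · have r1 := T0 h hn hm (i+1) m (by omega) (by omega) (by omega) (by omega) (by omega)
        have r2 := mvU h (i+1) (i-1) m r1
        have r3 := mvL h (i-1) m (m-1) r2
        exact mvD h (i-1) i (m-1) r3
      · have r1 := T0 h hn hm i (m-3) (by omega) (by omega) (by omega) (by omega) (by omega)
        have r2 := mvU h i 1 (m-3) r1
        have r3 := mvR h 1 (m-3) (m-1) r2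
        exact mvD h 1 i (m-1) r3
  exact mvL h i (m-1) (m-2) key

theorem T1_1 (h : Closed n m R) (hn : 12 ≤ n) (hm : 12 ≤ m) (i : ℤ) (h1 : 2 ≤ i) (h2 : i ≤ n - 1)
    (h5 : (i + m) % 4 = 2) : R i (m-1) := by
  have key : R i m := by
    by_cases c : i + 2 ≤ n - 1
    · have r := T0 h hn hm (i+2) m (by omega) (by omega) (by omega) (by omega) (by omega)
      exact mvU h (i+2) i m r
    · by_cases c2 : i = n - 1
      · have r1 := T0 h hn hm i (m-2) (by omega) (by omega) (by omega) (by omega) (by omega)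
        have r2 := mvD h i n (m-2) r1
        have r3 := mvR h n (m-2) m r2
        exact mvU h n i m r3
      · have r1 := T1_2 h hn hm (i+1) (by omega) (by omega) (by omega)
        have r2 := mvR h (i+1) (m-2) m r1
        exact mvU h (i+1) i m r2
  exact mvL h i m (m-1) key

theorem T1_0 (h : Closed n m R) (hn : 12 ≤ n) (hm : 12 ≤ m) (i : ℤ) (h1 : 2 ≤ i) (h2 : i ≤ n - 1)
    (h5 : (i + m) % 4 = 1) : R i m := by
  by_cases c : i = 2
  · have r1 := T0 h hn hm i (m-1) (by omega) (by omega) (by omega) (by omega) (by omega)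
    have r2 := mvU h i 1 (m-1) r1
    have r3 := mvR h 1 (m-1) m r2
    exact mvD h 1 i m r3
  · have r1 := T0 h hn hm (i-1) m (by omega) (by omega) (by omega) (by omega) (by omega)
    exact mvD h (i-1) i m r1

theorem E1 (h : Closed n m R) (hn : 12 ≤ n) (hm : 12 ≤ m) (i j : ℤ) (h1 : 2 ≤ i) (h2 : i ≤ n - 1)
    (h3 : 1 ≤ j) (h4 : j ≤ m) (h5 : (i + j) % 4 = 1) : R i j := by
  by_cases c : j ≤ m - 3
  · exact T1 h hn hm i j h1 h2 h3 c h5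
  · obtain rfl | rfl | rfl : j = m - 2 ∨ j = m - 1 ∨ j = m := by omega
    · exact T1_2 h hn hm i h1 h2 (by omega)
    · exact T1_1 h hn hm i h1 h2 (by omega)
    · exact T1_0 h hn hm i h1 h2 h5

theorem E2 (h : Closed n m R) (hn : 12 ≤ n) (hm : 12 ≤ m) (i j : ℤ) (h1 : 2 ≤ i) (h2 : i ≤ n - 1)
    (h3 : 1 ≤ j) (h4 : j ≤ m) (h5 : (i + j) % 4 = 2) : R i j := by
  by_cases c1 : j = 1
  · have r1 := E0 h hn hm i 3 (by omega) (by omega) (by omega) (by omega) (by omega)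
    exact mvL h i 3 j r1
  by_cases c2 : j = m
  · have r1 := E1 h hn hm i (m-1) (by omega) (by omega) (by omega) (by omega) (by omega)
    exact mvR h i (m-1) j r1
  by_cases c : i = 2
  · have r1 := E1 h hn hm i (j-1) (by omega) (by omega) (by omega) (by omega) (by omega)
    have r2 := mvU h i 1 (j-1) r1
    have r3 := mvR h 1 (j-1) j r2
    exact mvD h 1 i j r3
  · have r1 := E1 h hn hm (i-1) j (by omega) (by omega) (by omega) (by omega) (by omega)
    exact mvD h (i-1) i j r1

theorem E3 (h : Closed n m R) (hn : 12 ≤ n) (hm : 12 ≤ m) (i j : ℤ) (h1 : 2 ≤ i) (h2 : i ≤ n - 1)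
    (h3 : 1 ≤ j) (h4 : j ≤ m) (h5 : (i + j) % 4 = 3) : R i j := by
  by_cases c1 : j = 1
  · have r1 := E0 h hn hm i 2 (by omega) (by omega) (by omega) (by omega) (by omega)
    exact mvL h i 2 j r1
  by_cases c2 : j = m
  · have r1 := E1 h hn hm i (m-2) (by omega) (by omega) (by omega) (by omega) (by omega)
    exact mvR h i (m-2) j r1
  by_cases c : i = n - 1
  · have r1 := E0 h hn hm i (j+1) (by omega) (by omega) (by omega) (by omega) (by omega)
    have r2 := mvD h i n (j+1) r1
    have r3 := mvL h n (j+1) j r2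
    exact mvU h n i j r3
  · have r1 := E0 h hn hm (i+1) j (by omega) (by omega) (by omega) (by omega) (by omega)
    exact mvU h (i+1) i j r1

theorem EI (h : Closed n m R) (hn : 12 ≤ n) (hm : 12 ≤ m) (i j : ℤ) (h1 : 2 ≤ i) (h2 : i ≤ n - 1)
    (h3 : 1 ≤ j) (h4 : j ≤ m) : R i j := by
  obtain c | c | c | c : (i + j) % 4 = 0 ∨ (i + j) % 4 = 1 ∨ (i + j) % 4 = 2 ∨ (i + j) % 4 = 3 := by
    omega
  · exact E0 h hn hm i j h1 h2 h3 h4 c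
  · exact E1 h hn hm i j h1 h2 h3 h4 c
  · exact E2 h hn hm i j h1 h2 h3 h4 c
  · exact E3 h hn hm i j h1 h2 h3 h4 c

theorem Etop (h : Closed n m R) (hn : 12 ≤ n) (hm : 12 ≤ m) (j : ℤ)
    (h3 : 1 ≤ j) (h4 : j ≤ m) : R 1 j := by
  by_cases c1 : j = 1
  · rw [c1]; exact h.start
  by_cases c2 : j = m ∧ m % 4 = 0
  · have r1 := EI h hn hm 2 (m-1) (by omega) (by omega) (by omega) (by omega)
    have r2 := mvU h 2 1 (m-1) r1
    exact mvR h 1 (m-1) j r2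
  by_cases c3 : j < m ∧ j % 4 = 1
  · have r1 := EI h hn hm 2 (j+1) (by omega) (by omega) (by omega) (by omega)
    have r2 := mvU h 2 1 (j+1) r1
    exact mvL h 1 (j+1) j r2
  · have r1 := EI h hn hm 2 j (by omega) (by omega) (by omega) (by omega)
    exact mvU h 2 1 j r1

theorem Ebot (h : Closed n m R) (hn : 12 ≤ n) (hm : 12 ≤ m) (j : ℤ)
    (h3 : 1 ≤ j) (h4 : j ≤ m) : R n j := by
  by_cases c1 : j = 1 ∧ n % 4 = 3
  · have r1 := EI h hn hm (n-1) 2 (by omega) (by omega) (by omega) (by omega)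
    have r2 := mvD h (n-1) n 2 r1
    exact mvL h n 2 j r2
  by_cases c2 : j = m ∧ (n + m) % 4 = 2
  · have r1 := EI h hn hm (n-1) (m-1) (by omega) (by omega) (by omega) (by omega)
    have r2 := mvD h (n-1) n (m-1) r1
    exact mvR h n (m-1) j r2
  by_cases c3 : 1 < j ∧ j < m ∧ (n + j) % 4 = 3
  · have r1 := EI h hn hm (n-1) (j-1) (by omega) (by omega) (by omega) (by omega)
    have r2 := mvD h (n-1) n (j-1) r1
    exact mvR h n (j-1) j r2
  · have r1 := EI h hn hm (n-1) j (by omega) (by omega) (by omega) (by omega)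
    exact mvD h (n-1) n j r1

theorem Eall (h : Closed n m R) (hn : 12 ≤ n) (hm : 12 ≤ m) (i j : ℤ) (h1 : 1 ≤ i) (h2 : i ≤ n)
    (h3 : 1 ≤ j) (h4 : j ≤ m) : R i j := by
  by_cases c1 : i = 1
  · rw [c1]; exact Etop h hn hm j h3 h4
  by_cases c2 : i = n
  · rw [c2]; exact Ebot h hn hm j h3 h4
  exact EI h hn hm i j (by omega) (by omega) h3 h4

end

open Classical in
/-- the wall configuration -/
noncomputable def bigW (n m : ℕ) : Finset (Sq × Sq) :=
  (((Finset.Icc (1:ℤ) n ×ˢ Finset.Icc (1:ℤ) m).filter (fun p => vw n m p.1 p.2)).image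
    (fun p => (((p.1, p.2), (p.1, p.2 + 1)) : Sq × Sq))) ∪
  (((Finset.Icc (1:ℤ) n ×ˢ Finset.Icc (1:ℤ) m).filter (fun p => hw n m p.1 p.2)).image
    (fun p => (((p.1, p.2), (p.1 + 1, p.2)) : Sq × Sq)))

theorem mem_bigW (n m : ℕ) (a b c d : ℤ) : (((a, b), (c, d)) : Sq × Sq) ∈ bigW n m ↔
    (vw n m a b ∧ c = a ∧ d = b + 1) ∨ (hw n m a b ∧ c = a + 1 ∧ d = b) := by
  unfold bigW
  simp only [Finset.mem_union, Finset.mem_image, Finset.mem_filter, Finset.mem_product,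
    Finset.mem_Icc, Prod.exists, Prod.mk.injEq]
  constructor
  · rintro (⟨x, y, ⟨_, h⟩, ⟨rfl, rfl⟩, rfl, rfl⟩ | ⟨x, y, ⟨_, h⟩, ⟨rfl, rfl⟩, rfl, rfl⟩)
    · exact Or.inl ⟨h, rfl, rfl⟩
    · exact Or.inr ⟨h, rfl, rfl⟩
  · rintro (⟨h, rfl, rfl⟩ | ⟨h, rfl, rfl⟩)
    · refine Or.inl ⟨_, _, ⟨?_, h⟩, ⟨rfl, rfl⟩, rfl, rfl⟩
      unfold vw at h; omega
    · refine Or.inr ⟨_, _, ⟨?_, h⟩, ⟨rfl, rfl⟩, rfl, rfl⟩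
      unfold hw at h; omega

theorem wb_bigW (n m : ℕ) (a b c d : ℤ) : WallBetween (bigW n m) (a, b) (c, d) ↔
    (vw n m a b ∧ c = a ∧ d = b + 1) ∨ (hw n m a b ∧ c = a + 1 ∧ d = b) ∨
    (vw n m c d ∧ a = c ∧ b = d + 1) ∨ (hw n m c d ∧ a = c + 1 ∧ b = d) := by
  unfold WallBetween
  rw [mem_bigW, mem_bigW]; tauto

theorem bigW_ok (n m : ℕ) : WallsOK n m (bigW n m) := by
  rintro ⟨⟨a, b⟩, ⟨c, d⟩⟩ h
  rw [mem_bigW] at h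
  unfold IsWall inGrid
  simp only [Prod.mk_add_mk, Prod.mk.injEq]
  unfold vw hw at h
  omega

theorem wb_right (n m : ℕ) (i j : ℤ) : WallBetween (bigW n m) (i, j) (i, j+1) ↔ vw n m i j := by
  rw [wb_bigW]
  constructor
  · rintro (h | h | h | h)
    · exact h.1
    all_goals omega
  · intro h; exact Or.inl ⟨h, rfl, rfl⟩

theorem wb_down (n m : ℕ) (i j : ℤ) : WallBetween (bigW n m) (i, j) (i+1, j) ↔ hw n m i j := by
  rw [wb_bigW]
  constructor
  · rintro (h | h | h | h)
    · omega
    · exact h.1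
    all_goals omega
  · intro h; exact Or.inr (Or.inl ⟨h, rfl, rfl⟩)

theorem wb_symm (W : Finset (Sq × Sq)) (p q : Sq) : WallBetween W p q ↔ WallBetween W q p := by
  unfold WallBetween; tauto

theorem move_of (n m : ℕ) (i j di dj : ℤ) (k : ℕ) (hd : ((di, dj) : Sq) ∈ dirs4)
    (h1 : ∀ t : ℕ, t ≤ k → inGrid n m (i + t * di, j + t * dj))
    (h2 : ∀ t : ℕ, t < k → ¬ WallBetween (bigW n m) (i + t * di, j + t * dj)
      (i + (t + 1) * di, j + (t + 1) * dj))
    (h3 : ¬ inGrid n m (i + (k + 1) * di, j + (k + 1) * dj) ∨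
      WallBetween (bigW n m) (i + k * di, j + k * dj) (i + (k + 1) * di, j + (k + 1) * dj)) :
    MoveW n m (bigW n m) (i, j) (i + k * di, j + k * dj) := by
  refine ⟨(di, dj), hd, k, ⟨?_, ?_, ?_⟩, ?_⟩
  · simpa using h1
  · simpa using h2
  · simpa using h3
  · simp

theorem closed_bigW (n m : ℕ) :
    Closed n m (fun i j => ReachesW n m (bigW n m) (1, 1) (i, j)) where
  start := Relation.ReflTransGen.refl
  right := by
    intro i j j' hr h1 h2 h3 h4 h5 h6 h7
    obtain ⟨k, rfl⟩ := Int.le.dest h4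
    refine hr.tail ?_
    have := move_of n m i j 0 1 k (by simp [dirs4]) ?_ ?_ ?_
    · simpa using this
    · intro t ht; simp only [inGrid]; omega
    · intro t ht
      simp only [mul_zero, add_zero, mul_one, ← add_assoc]
      rw [wb_right]; exact h6 _ (by omega) (by omega)
    · simp only [mul_zero, add_zero, mul_one, ← add_assoc]
      rw [wb_right]
      rcases h7 with h7 | h7
      · left; simp only [inGrid]; omega
      · exact Or.inr h7
  left := by
    intro i j j' hr h1 h2 h3 h4 h5 h6 h7
    obtain ⟨k, rfl⟩ := Int.le.dest h4
    refine hr.tail ?_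
    have := move_of n m i (j' + k) 0 (-1) k (by simp [dirs4]) ?_ ?_ ?_
    · simpa using this
    · intro t ht; simp only [inGrid]; omega
    · intro t ht
      have := h6 (j' + k + (t + 1) * (-1)) (by omega) (by omega)
      rw [← wb_right, wb_symm] at this
      convert this using 3 <;> ring
    · rcases h7 with h7 | h7
      · left; simp only [inGrid]; omega
      · right
        rw [← wb_right, wb_symm] at h7
        convert h7 using 2 <;> ring_nf
  down := by
    intro i i' j hr h1 h2 h3 h4 h5 h6 h7
    obtain ⟨k, rfl⟩ := Int.le.dest h4
    refine hr.tail ?_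
    have := move_of n m i j 1 0 k (by simp [dirs4]) ?_ ?_ ?_
    · simpa using this
    · intro t ht; simp only [inGrid]; omega
    · intro t ht
      simp only [mul_zero, add_zero, mul_one, ← add_assoc]
      rw [wb_down]; exact h6 _ (by omega) (by omega)
    · simp only [mul_zero, add_zero, mul_one, ← add_assoc]
      rw [wb_down]
      rcases h7 with h7 | h7
      · left; simp only [inGrid]; omega
      · exact Or.inr h7
  up := by
    intro i i' j hr h1 h2 h3 h4 h5 h6 h7
    obtain ⟨k, rfl⟩ := Int.le.dest h4
    refine hr.tail ?_
    have := move_of n m (i' + k) j (-1) 0 k (by simp [dirs4]) ?_ ?_ ?_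
    · simpa using this
    · intro t ht; simp only [inGrid]; omega
    · intro t ht
      have := h6 (i' + k + (t + 1) * (-1)) (by omega) (by omega)
      rw [← wb_down, wb_symm] at this
      convert this using 3 <;> ring
    · rcases h7 with h7 | h7
      · left; simp only [inGrid]; omega
      · right
        rw [← wb_down, wb_symm] at h7
        convert h7 using 2 <;> ring_nf

theorem bigW_solves (n m : ℕ) (hn : 12 ≤ n) (hm : 12 ≤ m) : SolvesStopW n m (bigW n m) := by
  refine ⟨bigW_ok n m, ?_⟩
  rintro ⟨i, j⟩ ⟨h1, h2, h3, h4⟩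
  exact Eall (closed_bigW n m) (by omega) (by omega) i j h1 h2 h3 h4

theorem bigW_card (n m : ℕ) : (bigW n m).card ≤ 2 * (n * (m / 4 + 1)) + 2 * m + 2 * n := by
  classical
  have A : ((Finset.Icc (1:ℤ) n ×ˢ Finset.Icc (1:ℤ) m).filter
      (fun p => vw n m p.1 p.2)).card ≤ n * (m / 4 + 1) + 2 * m := by
    have hsub : (Finset.Icc (1:ℤ) n ×ˢ Finset.Icc (1:ℤ) m).filter (fun p => vw n m p.1 p.2) ⊆
        ((Finset.Icc (1:ℤ) n ×ˢ Finset.Icc (0:ℤ) ((m / 4 : ℕ) : ℤ)).image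
          (fun p => (p.1, 4 * p.2 + (-p.1) % 4))) ∪
        (({1, (n:ℤ)} : Finset ℤ) ×ˢ Finset.Icc (1:ℤ) m) := by
      rintro ⟨i, j⟩ h
      rw [Finset.mem_filter] at h
      replace h := h.2
      simp only [vw] at h
      simp only [Finset.mem_union, Finset.mem_image, Finset.mem_product, Finset.mem_Icc,
        Finset.mem_insert, Finset.mem_singleton]
      obtain ⟨h1, h2, h3, h4, h5 | h5 | h5⟩ := h
      · left
        refine ⟨(i, j / 4), ⟨⟨h1, h2⟩, ?_, ?_⟩, ?_⟩
        · dsimp only; omega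
        · dsimp only; omega
        · simp only [Prod.mk.injEq, true_and]; omega
      · right; omega
      · right; omega
    refine (Finset.card_le_card hsub).trans ((Finset.card_union_le _ _).trans ?_)
    refine Nat.add_le_add (Finset.card_image_le.trans ?_) ?_
    · rw [Finset.card_product]; simp [Int.card_Icc]
      apply le_of_eq; congr 1
    · rw [Finset.card_product]
      have : ({1, (n:ℤ)} : Finset ℤ).card ≤ 2 := Finset.card_le_two
      simp only [Int.card_Icc, add_sub_cancel_right, Int.toNat_natCast]
      gcongr
  have B : ((Finset.Icc (1:ℤ) n ×ˢ Finset.Icc (1:ℤ) m).filter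
      (fun p => hw n m p.1 p.2)).card ≤ n * (m / 4 + 1) + n * 2 := by
    have hsub : (Finset.Icc (1:ℤ) n ×ˢ Finset.Icc (1:ℤ) m).filter (fun p => hw n m p.1 p.2) ⊆
        ((Finset.Icc (1:ℤ) n ×ˢ Finset.Icc (0:ℤ) ((m / 4 : ℕ) : ℤ)).image
          (fun p => (p.1, 4 * p.2 + (2-p.1) % 4))) ∪
        (Finset.Icc (1:ℤ) n ×ˢ ({1, (m:ℤ)} : Finset ℤ)) := by
      rintro ⟨i, j⟩ h
      rw [Finset.mem_filter] at h
      replace h := h.2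
      simp only [hw] at h
      simp only [Finset.mem_union, Finset.mem_image, Finset.mem_product, Finset.mem_Icc,
        Finset.mem_insert, Finset.mem_singleton]
      obtain ⟨h1, h2, h3, h4, h5 | h5 | h5⟩ := h
      · left
        refine ⟨(i, j / 4), ⟨⟨h1, ?_⟩, ?_, ?_⟩, ?_⟩
        · dsimp only; omega
        · dsimp only; omega
        · dsimp only; omega
        · simp only [Prod.mk.injEq, true_and]; omega
      · right; omega
      · right; omega
    refine (Finset.card_le_card hsub).trans ((Finset.card_union_le _ _).trans ?_)
    refine Nat.add_le_add (Finset.card_image_le.trans ?_) ?_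
    · rw [Finset.card_product]; simp [Int.card_Icc]
      apply le_of_eq; congr 1
    · rw [Finset.card_product]
      have : ({1, (m:ℤ)} : Finset ℤ).card ≤ 2 := Finset.card_le_two
      simp only [Int.card_Icc, add_sub_cancel_right, Int.toNat_natCast]
      gcongr
  unfold bigW
  refine (Finset.card_union_le _ _).trans ?_
  have A' := (Finset.card_image_le (f := fun p : ℤ × ℤ =>
    (((p.1, p.2), (p.1, p.2 + 1)) : Sq × Sq))).trans A
  have B' := (Finset.card_image_le (f := fun p : ℤ × ℤ =>
    (((p.1, p.2), (p.1 + 1, p.2)) : Sq × Sq))).trans B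
  have := Nat.add_le_add A' B'
  refine le_trans (le_of_eq ?_) (this.trans (by omega))
  congr!

theorem lower (n m : ℕ) (W : Finset (Sq × Sq)) (h : SolvesStopW n m W) :
    n * m ≤ 2 * W.card + 2 * m + 2 * n + 1 := by
  classical
  have hsub : Finset.Icc (1:ℤ) n ×ˢ Finset.Icc (1:ℤ) m ⊆
      ((((W.image Prod.fst ∪ W.image Prod.snd) ∪
        (({1, (n:ℤ)} : Finset ℤ) ×ˢ Finset.Icc (1:ℤ) m)) ∪
        (Finset.Icc (1:ℤ) n ×ˢ ({1, (m:ℤ)} : Finset ℤ))) ∪ {((1, 1) : Sq)}) := by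
    rintro ⟨i, j⟩ hs
    simp only [Finset.mem_product, Finset.mem_Icc] at hs
    have hr := h.2 (i, j) ⟨hs.1.1, hs.1.2, hs.2.1, hs.2.2⟩
    rcases Relation.ReflTransGen.cases_tail hr with e | ⟨p, -, d, hd, k, ⟨-, -, hk⟩, e⟩
    · simp [← e]
    · have e2 : p + ((k:ℤ) + 1) • d = (i, j) + d := by rw [e, add_smul, one_smul, add_assoc]
      rw [e2, ← e] at hk
      rcases hk with hk | hk
      · have : (i = 1 ∨ i = n) ∨ (j = 1 ∨ j = m) := by
          simp only [dirs4, Set.mem_insert_iff, Set.mem_singleton_iff] at hd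
          rcases hd with rfl | rfl | rfl | rfl <;> simp only [inGrid, Prod.mk_add_mk] at hk <;> omega
        simp only [Finset.mem_union, Finset.mem_product, Finset.mem_Icc,
          Finset.mem_insert, Finset.mem_singleton]
        tauto
      · have : (i, j) ∈ W.image Prod.fst ∪ W.image Prod.snd := by
          rw [Finset.mem_union, Finset.mem_image, Finset.mem_image]
          rcases hk with hk | hk
          · exact Or.inl ⟨_, hk, rfl⟩
          · exact Or.inr ⟨_, hk, rfl⟩
        simp only [Finset.mem_union] at this ⊢
        tauto
  have c := Finset.card_le_card hsub
  have c0 := Finset.card_union_le (((W.image Prod.fst ∪ W.image Prod.snd) ∪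
        (({1, (n:ℤ)} : Finset ℤ) ×ˢ Finset.Icc (1:ℤ) m)) ∪
        (Finset.Icc (1:ℤ) n ×ˢ ({1, (m:ℤ)} : Finset ℤ))) {((1, 1) : Sq)}
  have c1 := Finset.card_union_le ((W.image Prod.fst ∪ W.image Prod.snd) ∪
        (({1, (n:ℤ)} : Finset ℤ) ×ˢ Finset.Icc (1:ℤ) m))
        (Finset.Icc (1:ℤ) n ×ˢ ({1, (m:ℤ)} : Finset ℤ))
  have c2 := Finset.card_union_le (W.image Prod.fst ∪ W.image Prod.snd)
        (({1, (n:ℤ)} : Finset ℤ) ×ˢ Finset.Icc (1:ℤ) m)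
  have c3 := Finset.card_union_le (W.image Prod.fst) (W.image Prod.snd)
  have c4 : (W.image Prod.fst).card ≤ W.card := Finset.card_image_le
  have c5 : (W.image Prod.snd).card ≤ W.card := Finset.card_image_le
  have c6 : (({1, (n:ℤ)} : Finset ℤ) ×ˢ Finset.Icc (1:ℤ) m).card ≤ 2 * m := by
    rw [Finset.card_product]
    have : ({1, (n:ℤ)} : Finset ℤ).card ≤ 2 := Finset.card_le_two
    simp only [Int.card_Icc, add_sub_cancel_right, Int.toNat_natCast]
    gcongr
  have c7 : (Finset.Icc (1:ℤ) n ×ˢ ({1, (m:ℤ)} : Finset ℤ)).card ≤ n * 2 := by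
    rw [Finset.card_product]
    have : ({1, (m:ℤ)} : Finset ℤ).card ≤ 2 := Finset.card_le_two
    simp only [Int.card_Icc, add_sub_cancel_right, Int.toNat_natCast]
    gcongr
  have c8 : (Finset.Icc (1:ℤ) n ×ˢ Finset.Icc (1:ℤ) m).card = n * m := by
    rw [Finset.card_product]; simp
  rw [Finset.card_singleton] at c0
  omega

/-- Asymptotically, `opt^S_W(G_{n,m}) = nm/2 + O(m+n)`: there are constants `C > 0`
and `N` such that `|opt^S_W(G_{n,m}) - nm/2| ≤ C (m+n)` for all `n ≥ m ≥ N`. -/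
theorem stmt18 :
    ∃ C : ℝ, 0 < C ∧ ∃ N : ℕ, ∀ n m : ℕ, N ≤ m → m ≤ n →
      |(optSW n m : ℝ) - (n : ℝ) * m / 2| ≤ C * ((m : ℝ) + n) := by
  refine ⟨4, by norm_num, 12, ?_⟩
  intro n m hm hnm
  have hs := bigW_solves n m (by omega) hm
  have hu : optSW n m ≤ (bigW n m).card := Nat.sInf_le ⟨_, hs, rfl⟩
  have hu2 := hu.trans (bigW_card n m)
  obtain ⟨W, hW, hc⟩ : optSW n m ∈ {k | ∃ W : Finset (Sq × Sq), SolvesStopW n m W ∧ W.card = k} :=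
    Nat.sInf_mem ⟨_, _, hs, rfl⟩
  have hl := lower n m W hW
  rw [hc] at hl
  have hl' : (n:ℝ) * m ≤ 2 * optSW n m + 2 * m + 2 * n + 1 := by exact_mod_cast hl
  have hu' : (optSW n m : ℝ) ≤ 2 * (n * (((m / 4 : ℕ) : ℝ) + 1)) + 2 * m + 2 * n := by
    exact_mod_cast hu2
  have hd : ((m / 4 : ℕ) : ℝ) ≤ (m:ℝ) / 4 := by exact_mod_cast Nat.cast_div_le
  have hn0 : (0:ℝ) ≤ n := Nat.cast_nonneg n
  have hm0 : (12:ℝ) ≤ m := by exact_mod_cast hm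
  have hmul := mul_le_mul_of_nonneg_left hd hn0
  rw [abs_le]
  constructor <;> nlinarith
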